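/- For a 3-form α and a p-form β in the Clifford algebra, the Clifford product decomposes as αβ = α∧β + α∧₁β − (1/2)α∧₂β − (1/6)α∧₃β, and βα = (-1)^p(α∧β − α∧₁β − (1/2)α∧₂β + (1/6)α∧₃β). -/

import Mathlib

noncomputable section
open CliffordAlgebra

variable {V : Type*} [AddCommGroup V] [Module ℝ V]

/-- The Clifford product (with respect to the quadratic form `Q`, the metric)
transported to the exterior algebra via `CliffordAlgebra.equivExterior`. -/
def cliffMul (Q : QuadraticForm ℝ V) (α β : ExteriorAlgebra ℝ V) : ExteriorAlgebra ℝ V :=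
  equivExterior Q ((equivExterior Q).symm α * (equivExterior Q).symm β)

/-- The submodule of `p`-forms: the `p`-th exterior power inside the exterior algebra. -/
def formGrade (p : ℕ) : Submodule ℝ (ExteriorAlgebra ℝ V) :=
  LinearMap.range (ExteriorAlgebra.ι ℝ : V →ₗ[ℝ] ExteriorAlgebra ℝ V) ^ p

/-- Interior contraction `v⌟ ·` of a form by the vector `v`, using the metric
(through the symmetric bilinear form associated to `Q`). -/
def contr (Q : QuadraticForm ℝ V) (v : V) :
    ExteriorAlgebra ℝ V →ₗ[ℝ] ExteriorAlgebra ℝ V :=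
  contractLeft (Q := (0 : QuadraticForm ℝ V)) (QuadraticMap.associated (R := ℝ) Q v)

variable {ι : Type*} [Fintype ι] [DecidableEq ι]

/-- The `n`-fold contracted wedge product `α∧ₙβ`, defined inductively by
`α∧₀β = α∧β` and `α∧ₙβ = (Xₐ⌟α)∧_{n-1}(X^a⌟β)` (sum over `a`), where `Xl`/`Xu`
are a dual pair of orthonormal frames. -/
def cwedge (Q : QuadraticForm ℝ V) (Xl Xu : ι → V) :
    ℕ → ExteriorAlgebra ℝ V → ExteriorAlgebra ℝ V → ExteriorAlgebra ℝ V
  | 0, α, β => α * β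
  | n + 1, α, β => ∑ a, cwedge Q Xl Xu n (contr Q (Xl a) α) (contr Q (Xu a) β)

/-- `Xl` and `Xu` are mutually dual frames for the metric. -/
def DualFrames (Q : QuadraticForm ℝ V) (Xl Xu : ι → V) : Prop :=
  (∀ i j, QuadraticMap.associated (R := ℝ) Q (Xl i) (Xu j) = if i = j then 1 else 0) ∧
  (∀ w : V, ∑ a, (QuadraticMap.associated (R := ℝ) Q w (Xu a)) • Xl a = w) ∧
  (∀ w : V, ∑ a, (QuadraticMap.associated (R := ℝ) Q w (Xl a)) • Xu a = w)

local notation "e" => (ExteriorAlgebra.ι ℝ)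

theorem contr_e_mul (Q : QuadraticForm ℝ V) (v w : V) (x : ExteriorAlgebra ℝ V) :
    contr Q v (e w * x) = (QuadraticMap.associated (R := ℝ) Q v w) • x - e w * contr Q v x :=
  contractLeft_ι_mul _ _ _

theorem contr_e (Q : QuadraticForm ℝ V) (v w : V) :
    contr Q v (e w) = (QuadraticMap.associated (R := ℝ) Q v w) • (1 : ExteriorAlgebra ℝ V) := by
  rw [← Algebra.algebraMap_eq_smul_one]
  exact contractLeft_ι _ _ _

theorem contr_one (Q : QuadraticForm ℝ V) (v : V) :
    contr Q v (1 : ExteriorAlgebra ℝ V) = 0 :=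
  contractLeft_one _ _

theorem contr_comm (Q : QuadraticForm ℝ V) (v w : V) (x : ExteriorAlgebra ℝ V) :
    contr Q v (contr Q w x) = - contr Q w (contr Q v x) :=
  contractLeft_comm _ _ _

theorem contr_add_vec (Q : QuadraticForm ℝ V) (v w : V) :
    contr Q (v + w) = contr Q v + contr Q w := by
  simp [contr]

theorem contr_smul_vec (Q : QuadraticForm ℝ V) (r : ℝ) (w : V) :
    contr Q (r • w) = r • contr Q w := by
  simp [contr]

def contrL (Q : QuadraticForm ℝ V) :
    V →ₗ[ℝ] ExteriorAlgebra ℝ V →ₗ[ℝ] ExteriorAlgebra ℝ V where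
  toFun := contr Q
  map_add' := contr_add_vec Q
  map_smul' := contr_smul_vec Q

theorem g_symm (Q : QuadraticForm ℝ V) (v w : V) :
    QuadraticMap.associated (R := ℝ) Q v w = QuadraticMap.associated (R := ℝ) Q w v :=
  QuadraticMap.associated_isSymm ℝ Q v w

theorem e_anti (v w : V) : (e v * e w : ExteriorAlgebra ℝ V) = - (e w * e v) :=
  eq_neg_of_add_eq_zero_left (ExteriorAlgebra.ι_add_mul_swap v w)

theorem e_anti' (v w : V) (x : ExteriorAlgebra ℝ V) : e v * (e w * x) = - (e w * (e v * x)) := by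
  rw [← mul_assoc, e_anti, neg_mul, mul_assoc]

theorem equiv_mul (Q : QuadraticForm ℝ V) (v : V) (x : CliffordAlgebra Q) :
    equivExterior Q (CliffordAlgebra.ι Q v * x)
      = e v * equivExterior Q x + contr Q v (equivExterior Q x) := by
  refine (changeForm_ι_mul changeForm.associated_neg_proof v x).trans ?_
  have h : QuadraticMap.associated (R := ℝ) (-Q) v = - QuadraticMap.associated (R := ℝ) Q v := by
    rw [map_neg, LinearMap.neg_apply]
  have h2 : ∀ y : ExteriorAlgebra ℝ V, contractLeft (Q := (0 : QuadraticForm ℝ V))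
      (QuadraticMap.associated (R := ℝ) (-Q) v) y = - contr Q v y := fun y => by
    rw [h, map_neg]
    rfl
  erw [h2, sub_neg_eq_add]
  rfl

theorem equiv_ι (Q : QuadraticForm ℝ V) (v : V) :
    equivExterior Q (CliffordAlgebra.ι Q v) = e v :=
  changeForm_ι changeForm.associated_neg_proof v

theorem equiv_algebraMap (Q : QuadraticForm ℝ V) (r : ℝ) :
    equivExterior Q (algebraMap ℝ _ r) = algebraMap ℝ _ r :=
  changeForm_algebraMap changeForm.associated_neg_proof r

def inv0 : ExteriorAlgebra ℝ V →ₐ[ℝ] ExteriorAlgebra ℝ V :=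
  involute (Q := (0 : QuadraticForm ℝ V))

theorem inv0_e (v : V) : inv0 (e v : ExteriorAlgebra ℝ V) = - e v := involute_ι _

theorem inv0_contr (Q : QuadraticForm ℝ V) (v : V) (x : ExteriorAlgebra ℝ V) :
    inv0 (contr Q v x) = - contr Q v (inv0 x) := by
  induction x using CliffordAlgebra.left_induction with
  | algebraMap r =>
    have h : contr Q v (algebraMap ℝ (ExteriorAlgebra ℝ V) r) = 0 := contractLeft_algebraMap _ _ _
    have h2 : inv0 (algebraMap ℝ (ExteriorAlgebra ℝ V) r) = algebraMap ℝ _ r := inv0.commutes r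
    erw [h2, h]
    simp
  | add x y hx hy => rw [map_add, map_add, map_add, map_add, hx, hy, neg_add]
  | ι_mul x m hx =>
    change inv0 (contr Q v (e m * x)) = - contr Q v (inv0 (e m * x))
    rw [contr_e_mul, map_mul, inv0_e, neg_mul, map_neg, contr_e_mul, map_sub, map_mul, map_smul,
      hx, inv0_e]
    simp

theorem inv0_grade (p : ℕ) (x : ExteriorAlgebra ℝ V) (hx : x ∈ formGrade p) :
    inv0 x = (-1 : ℝ) ^ p • x := by
  unfold formGrade at hx
  induction hx using Submodule.pow_induction_on_left' with
  | algebraMap r => simp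
  | add x y i hx hy h1 h2 => rw [map_add, h1, h2, smul_add]
  | mem_mul m hm i x hx h =>
    obtain ⟨v, rfl⟩ := hm
    rw [map_mul, inv0_e, h, pow_succ]
    simp

theorem equiv_mul_right (Q : QuadraticForm ℝ V) (v : V) (x : CliffordAlgebra Q) :
    equivExterior Q (x * CliffordAlgebra.ι Q v)
      = e v * inv0 (equivExterior Q x) - contr Q v (inv0 (equivExterior Q x)) := by
  induction x using CliffordAlgebra.left_induction with
  | algebraMap r =>
    rw [← Algebra.smul_def, map_smul, equiv_ι, equiv_algebraMap, inv0.commutes,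
      Algebra.algebraMap_eq_smul_one, map_smul, contr_one]
    simp
  | add x y hx hy =>
    simp only [add_mul, map_add, hx, hy, mul_add]
    abel
  | ι_mul x m hx =>
    rw [mul_assoc, equiv_mul, hx, equiv_mul]
    generalize equivExterior Q x = y
    simp only [map_add, map_sub, map_mul, inv0_contr, inv0_e, map_neg, contr_e_mul, mul_add,
      mul_sub, neg_mul, mul_neg]
    rw [e_anti' m v, contr_comm Q m v, g_symm Q m v]
    abel

theorem symm_three (Q : QuadraticForm ℝ V) (a b c : V) :
    (equivExterior Q).symm (e a * (e b * e c)) =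
      CliffordAlgebra.ι Q a * (CliffordAlgebra.ι Q b * CliffordAlgebra.ι Q c)
      - (QuadraticMap.associated (R := ℝ) Q b c) • CliffordAlgebra.ι Q a
      - (QuadraticMap.associated (R := ℝ) Q a b) • CliffordAlgebra.ι Q c
      + (QuadraticMap.associated (R := ℝ) Q a c) • CliffordAlgebra.ι Q b := by
  rw [LinearEquiv.symm_apply_eq]
  simp only [map_add, map_sub, map_smul, equiv_mul, equiv_ι, contr_e_mul, contr_e, mul_add,
    contr_one, mul_smul_comm, mul_one, smul_zero]
  abel

theorem cwedge_add (Q : QuadraticForm ℝ V) (Xl Xu : ι → V) (n : ℕ)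
    (x y z : ExteriorAlgebra ℝ V) :
    cwedge Q Xl Xu n (x + y) z = cwedge Q Xl Xu n x z + cwedge Q Xl Xu n y z := by
  induction n generalizing x y z with
  | zero => exact add_mul _ _ _
  | succ n ih => simp only [cwedge, map_add, ih, Finset.sum_add_distrib]

theorem cwedge_smul (Q : QuadraticForm ℝ V) (Xl Xu : ι → V) (n : ℕ) (r : ℝ)
    (x z : ExteriorAlgebra ℝ V) :
    cwedge Q Xl Xu n (r • x) z = r • cwedge Q Xl Xu n x z := by
  induction n generalizing x z with
  | zero => exact smul_mul_assoc _ _ _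
  | succ n ih => simp only [cwedge, map_smul, ih, Finset.smul_sum]

theorem cwedge_add_right (Q : QuadraticForm ℝ V) (Xl Xu : ι → V) (n : ℕ)
    (x y z : ExteriorAlgebra ℝ V) :
    cwedge Q Xl Xu n z (x + y) = cwedge Q Xl Xu n z x + cwedge Q Xl Xu n z y := by
  induction n generalizing x y z with
  | zero => exact mul_add _ _ _
  | succ n ih => simp only [cwedge, map_add, ih, Finset.sum_add_distrib]

theorem cwedge_smul_right (Q : QuadraticForm ℝ V) (Xl Xu : ι → V) (n : ℕ) (r : ℝ)
    (x z : ExteriorAlgebra ℝ V) :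
    cwedge Q Xl Xu n x (r • z) = r • cwedge Q Xl Xu n x z := by
  induction n generalizing x z with
  | zero => exact mul_smul_comm _ _ _
  | succ n ih => simp only [cwedge, map_smul, ih, Finset.smul_sum]

def cwedgeL (Q : QuadraticForm ℝ V) (Xl Xu : ι → V) (n : ℕ) :
    ExteriorAlgebra ℝ V →ₗ[ℝ] ExteriorAlgebra ℝ V →ₗ[ℝ] ExteriorAlgebra ℝ V :=
  LinearMap.mk₂ ℝ (cwedge Q Xl Xu n) (cwedge_add Q Xl Xu n) (cwedge_smul Q Xl Xu n)
    (fun z x y => cwedge_add_right Q Xl Xu n x y z)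
    (fun r x z => cwedge_smul_right Q Xl Xu n r x z)

theorem cwedgeL_zero (Q : QuadraticForm ℝ V) (Xl Xu : ι → V) (x y : ExteriorAlgebra ℝ V) :
    cwedgeL Q Xl Xu 0 x y = x * y := rfl

theorem cwedgeL_succ (Q : QuadraticForm ℝ V) (Xl Xu : ι → V) (n : ℕ)
    (x y : ExteriorAlgebra ℝ V) :
    cwedgeL Q Xl Xu (n + 1) x y =
      ∑ a, cwedgeL Q Xl Xu n (contr Q (Xl a) x) (contr Q (Xu a) y) := rfl

theorem sum_contr (Q : QuadraticForm ℝ V) (Xl Xu : ι → V) (hX : DualFrames Q Xl Xu) (n : ℕ)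
    (w : V) (x y : ExteriorAlgebra ℝ V) :
    ∑ a, (QuadraticMap.associated (R := ℝ) Q (Xl a) w) •
      cwedgeL Q Xl Xu n x (contr Q (Xu a) y) = cwedgeL Q Xl Xu n x (contr Q w y) := by
  have h : contr Q w y = ∑ a, (QuadraticMap.associated (R := ℝ) Q (Xl a) w) •
      contr Q (Xu a) y := by
    conv_lhs => rw [← hX.2.2 w]
    change (contrL Q) _ y = _
    rw [map_sum, LinearMap.sum_apply]
    refine Finset.sum_congr rfl fun a _ => ?_
    rw [map_smul, g_symm Q w]
    rfl
  rw [h, map_sum]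
  simp only [map_smul]

theorem cw1 (Q : QuadraticForm ℝ V) (Xl Xu : ι → V) (hX : DualFrames Q Xl Xu) (n : ℕ)
    (a : V) (y : ExteriorAlgebra ℝ V) :
    cwedgeL Q Xl Xu (n + 1) (e a) y = cwedgeL Q Xl Xu n 1 (contr Q a y) := by
  rw [cwedgeL_succ, ← sum_contr Q Xl Xu hX]
  simp only [contr_e, map_smul, LinearMap.smul_apply]

theorem cw2 (Q : QuadraticForm ℝ V) (Xl Xu : ι → V) (hX : DualFrames Q Xl Xu) (n : ℕ)
    (a b : V) (y : ExteriorAlgebra ℝ V) :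
    cwedgeL Q Xl Xu (n + 1) (e a * e b) y = cwedgeL Q Xl Xu n (e b) (contr Q a y)
      - cwedgeL Q Xl Xu n (e a) (contr Q b y) := by
  rw [cwedgeL_succ, ← sum_contr Q Xl Xu hX, ← sum_contr Q Xl Xu hX n b]
  simp only [contr_e_mul, contr_e, mul_smul_comm, mul_one, map_sub, LinearMap.sub_apply,
    map_smul, LinearMap.smul_apply, Finset.sum_sub_distrib]

theorem cw3 (Q : QuadraticForm ℝ V) (Xl Xu : ι → V) (hX : DualFrames Q Xl Xu) (n : ℕ)
    (a b c : V) (y : ExteriorAlgebra ℝ V) :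
    cwedgeL Q Xl Xu (n + 1) (e a * (e b * e c)) y = cwedgeL Q Xl Xu n (e b * e c) (contr Q a y)
      - cwedgeL Q Xl Xu n (e a * e c) (contr Q b y)
      + cwedgeL Q Xl Xu n (e a * e b) (contr Q c y) := by
  rw [cwedgeL_succ, ← sum_contr Q Xl Xu hX, ← sum_contr Q Xl Xu hX n b,
    ← sum_contr Q Xl Xu hX n c, ← Finset.sum_sub_distrib, ← Finset.sum_add_distrib]
  refine Finset.sum_congr rfl fun i _ => ?_
  simp only [contr_e_mul, contr_e, mul_smul_comm, mul_one, map_sub, LinearMap.sub_apply,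
    map_smul, LinearMap.smul_apply, mul_sub]
  abel

theorem cwedge_1 (Q : QuadraticForm ℝ V) (Xl Xu : ι → V) (hX : DualFrames Q Xl Xu)
    (a b c : V) (y : ExteriorAlgebra ℝ V) :
    cwedge Q Xl Xu 1 (e a * (e b * e c)) y = e b * (e c * contr Q a y)
      - e a * (e c * contr Q b y) + e a * (e b * contr Q c y) := by
  refine (cw3 Q Xl Xu hX 0 a b c y).trans ?_
  simp only [cwedgeL_zero, mul_assoc]

theorem cwedge_2 (Q : QuadraticForm ℝ V) (Xl Xu : ι → V) (hX : DualFrames Q Xl Xu)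
    (a b c : V) (y : ExteriorAlgebra ℝ V) :
    cwedge Q Xl Xu 2 (e a * (e b * e c)) y = (2 : ℝ) • (e c * contr Q b (contr Q a y)
      - e b * contr Q c (contr Q a y) + e a * contr Q c (contr Q b y)) := by
  refine (cw3 Q Xl Xu hX 1 a b c y).trans ?_
  simp only [cw2 Q Xl Xu hX 0, cwedgeL_zero, mul_assoc]
  rw [contr_comm Q a b, contr_comm Q a c, contr_comm Q b c]
  simp only [mul_neg]
  module

theorem cwedge_3 (Q : QuadraticForm ℝ V) (Xl Xu : ι → V) (hX : DualFrames Q Xl Xu)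
    (a b c : V) (y : ExteriorAlgebra ℝ V) :
    cwedge Q Xl Xu 3 (e a * (e b * e c)) y = (6 : ℝ) • contr Q c (contr Q b (contr Q a y)) := by
  refine (cw3 Q Xl Xu hX 2 a b c y).trans ?_
  simp only [cw2 Q Xl Xu hX 1, cw1 Q Xl Xu hX 0, cwedgeL_zero, one_mul]
  rw [contr_comm Q b c y, contr_comm Q a c y, contr_comm Q a b y,
    contr_comm Q b c (contr Q a y)]
  simp only [map_neg]
  rw [contr_comm Q a c, contr_comm Q b c, contr_comm Q a b y]
  simp only [map_neg]
  module

theorem left_three (Q : QuadraticForm ℝ V) (Xl Xu : ι → V) (hX : DualFrames Q Xl Xu)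
    (a b c : V) (y : ExteriorAlgebra ℝ V) :
    cliffMul Q (e a * (e b * e c)) y = cwedge Q Xl Xu 0 (e a * (e b * e c)) y
      + cwedge Q Xl Xu 1 (e a * (e b * e c)) y
      - ((1 : ℝ) / 2) • cwedge Q Xl Xu 2 (e a * (e b * e c)) y
      - ((1 : ℝ) / 6) • cwedge Q Xl Xu 3 (e a * (e b * e c)) y := by
  rw [cwedge_1 Q Xl Xu hX, cwedge_2 Q Xl Xu hX, cwedge_3 Q Xl Xu hX, cwedge, cliffMul, symm_three]
  simp only [add_mul, sub_mul, smul_mul_assoc, mul_assoc, map_add, map_sub, map_smul, equiv_mul,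
    LinearEquiv.apply_symm_apply, contr_e_mul, mul_add, mul_sub, mul_smul_comm]
  rw [contr_comm Q b c, contr_comm Q a c, contr_comm Q a b]
  simp only [map_neg, mul_neg]
  rw [contr_comm Q a c, contr_comm Q a b]
  simp only [map_neg, mul_neg]
  module

theorem right_three (Q : QuadraticForm ℝ V) (Xl Xu : ι → V) (hX : DualFrames Q Xl Xu)
    (a b c : V) (p : ℕ) (y : ExteriorAlgebra ℝ V) (hy : y ∈ formGrade p) :
    cliffMul Q y (e a * (e b * e c)) = (-1 : ℝ) ^ p • (cwedge Q Xl Xu 0 (e a * (e b * e c)) y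
      - cwedge Q Xl Xu 1 (e a * (e b * e c)) y
      - ((1 : ℝ) / 2) • cwedge Q Xl Xu 2 (e a * (e b * e c)) y
      + ((1 : ℝ) / 6) • cwedge Q Xl Xu 3 (e a * (e b * e c)) y) := by
  rw [cwedge_1 Q Xl Xu hX, cwedge_2 Q Xl Xu hX, cwedge_3 Q Xl Xu hX, cwedge, cliffMul, symm_three]
  simp only [mul_add, mul_sub, mul_smul_comm, ← mul_assoc, map_add, map_sub, map_smul,
    equiv_mul_right, LinearEquiv.apply_symm_apply, inv0_grade p y hy]
  simp only [mul_assoc, map_add, map_sub, map_smul, map_mul, map_neg, inv0_contr, inv0_e,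
    inv0_grade p y hy, contr_e_mul, mul_add, mul_sub, mul_smul_comm, neg_mul, mul_neg, neg_neg]
  rw [g_symm Q c b, g_symm Q c a, g_symm Q b a]
  rw [e_anti' c b, e_anti' c a, e_anti' b a, e_anti' c b, e_anti' c a]
  simp only [mul_neg]
  try rw [e_anti' c a]
  try rw [e_anti' b a]
  try simp only [mul_neg]
  rcases neg_one_pow_eq_or ℝ p with h | h <;> rw [h] <;> module

/-- for a 3-form `α` and a `p`-form `β`, the Clifford product decomposes
as `αβ = α∧β + α∧₁β − (1/2)α∧₂β − (1/6)α∧₃β` and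
`βα = (-1)^p (α∧β − α∧₁β − (1/2)α∧₂β + (1/6)α∧₃β)`. -/
theorem clifford_product_three_form (Q : QuadraticForm ℝ V) (Xl Xu : ι → V)
    (hX : DualFrames Q Xl Xu) (p : ℕ)
    (α β : ExteriorAlgebra ℝ V) (hα : α ∈ formGrade 3) (hβ : β ∈ formGrade p) :
    cliffMul Q α β
        = cwedge Q Xl Xu 0 α β + cwedge Q Xl Xu 1 α β
          - ((1 : ℝ) / 2) • cwedge Q Xl Xu 2 α β - ((1 : ℝ) / 6) • cwedge Q Xl Xu 3 α β ∧
    cliffMul Q β α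
        = ((-1 : ℝ)) ^ p • (cwedge Q Xl Xu 0 α β - cwedge Q Xl Xu 1 α β
          - ((1 : ℝ) / 2) • cwedge Q Xl Xu 2 α β + ((1 : ℝ) / 6) • cwedge Q Xl Xu 3 α β) := by
  have h3 : α ∈ Submodule.span ℝ (Set.range (ExteriorAlgebra.ιMulti ℝ (M := V) 3)) := by
    rw [ExteriorAlgebra.ιMulti_span_fixedDegree]
    exact hα
  clear hα
  induction h3 using Submodule.span_induction with
  | mem x hx =>
    obtain ⟨v, rfl⟩ := hx
    have hv : ExteriorAlgebra.ιMulti ℝ 3 v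
        = ExteriorAlgebra.ι ℝ (v 0) * (ExteriorAlgebra.ι ℝ (v 1) * ExteriorAlgebra.ι ℝ (v 2)) := by
      simp [ExteriorAlgebra.ιMulti_apply]
      rfl
    rw [hv]
    exact ⟨left_three Q Xl Xu hX _ _ _ β, right_three Q Xl Xu hX _ _ _ p β hβ⟩
  | zero =>
    have h : ∀ n, cwedge Q Xl Xu n 0 β = 0 := fun n => by
      simpa using cwedge_smul Q Xl Xu n 0 0 β
    simp [h, cliffMul]
  | add x y _ _ hx hy =>
    have h1 : cliffMul Q (x + y) β = cliffMul Q x β + cliffMul Q y β := by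
      simp only [cliffMul, map_add, add_mul]
    have h2 : cliffMul Q β (x + y) = cliffMul Q β x + cliffMul Q β y := by
      simp only [cliffMul, map_add, mul_add]
    rw [h1, h2, hx.1, hx.2, hy.1, hy.2]
    simp only [cwedge_add]
    constructor <;> module
  | smul r x _ hx =>
    have h1 : cliffMul Q (r • x) β = r • cliffMul Q x β := by
      simp only [cliffMul, map_smul, smul_mul_assoc]
    have h2 : cliffMul Q β (r • x) = r • cliffMul Q β x := by
      simp only [cliffMul, map_smul, mul_smul_comm]
    rw [h1, h2, hx.1, hx.2]
    simp only [cwedge_smul]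
    constructor <;> module
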